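/- Let X be a second countable, locally compact Hausdorff space and weak H_X an X-module. Let T : [1,∞) → 𝓛(H_X) be a bounded family of operators, continuous in the strong-* operator topology, such that lim_{t→∞} ‖[T_t, φ]‖ = 0 for every φ ∈ C₀(X). Then T multiplies the representable localization algebra: for every S ∈ RL*_c(H_X), the pointwise products t ↦ T_t S_t and t ↦ S_t T_t again belong to RL*_c(H_X). In particular this holds whenever prop(T_t) → 0 as t → ∞ with respect to some (any) metric on the one-point compactification X⁺ compatible with its topology. -/

import Mathlib

open scoped ZeroAtInfty
open Filter Topology MeasureTheory

noncomputable section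

namespace Stmt

variable {X : Type*} [TopologicalSpace X]
variable {H : Type*} [NormedAddCommGroup H] [InnerProductSpace ℂ H] [CompleteSpace H]

/-- `π` is a nondegenerate ⋆-representation of `C₀(X, ℂ)` on the Hilbert space `H`,
i.e. `H` is an `X`-module. -/
structure IsStarRep (π : C₀(X, ℂ) → H →L[ℂ] H) : Prop where
  map_add : ∀ φ ψ, π (φ + ψ) = π φ + π ψ
  map_smul : ∀ (a : ℂ) (φ), π (a • φ) = a • π φ
  map_mul : ∀ φ ψ, π (φ * ψ) = (π φ).comp (π ψ)
  map_star : ∀ φ, ContinuousLinearMap.adjoint (π φ) = π (star φ)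
  nondeg : Dense (↑(Submodule.span ℂ (Set.range fun p : C₀(X, ℂ) × H => π p.1 p.2)) : Set H)

/-- The support of an operator `T` on an `X`-module: the set of pairs `(y, x) ∈ X × X`
near which `T` does not vanish. -/
def opSupport (π : C₀(X, ℂ) → H →L[ℂ] H) (T : H →L[ℂ] H) : Set (X × X) :=
  {p | ∀ U V : Set X, IsOpen U → IsOpen V → p.2 ∈ U → p.1 ∈ V →
      ∃ φ ψ : C₀(X, ℂ), tsupport ⇑φ ⊆ U ∧ tsupport ⇑ψ ⊆ V ∧
        (π ψ).comp (T.comp (π φ)) ≠ 0}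

/-- The function `x ↦ f x - f ∞` on `X`, for `f` a continuous function on the one-point
compactification of `X`; it vanishes at infinity. -/
def onePointRestrict (f : C(OnePoint X, ℂ)) : C₀(X, ℂ) where
  toFun x := f x - f OnePoint.infty
  continuous_toFun := (f.continuous.comp OnePoint.continuous_coe).sub continuous_const
  zero_at_infty' := by
    have h1 : Tendsto ((↑) : X → OnePoint X) (cocompact X) (𝓝 (OnePoint.infty)) :=
      OnePoint.tendsto_coe_infty.mono_left cocompact_le_coclosedCompact
    have h2 : Tendsto (fun x : X => f x - f OnePoint.infty) (cocompact X)
        (𝓝 (f OnePoint.infty - f OnePoint.infty)) :=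
      ((f.continuous.tendsto _).comp h1).sub tendsto_const_nhds
    simpa using h2

/-- The canonical action of `C(X⁺, ℂ)` on an `X`-module, extending the action of
`C₀(X, ℂ)` unitally (`X⁺` being the one-point compactification of `X`). -/
def onePointAct (π : C₀(X, ℂ) → H →L[ℂ] H) (f : C(OnePoint X, ℂ)) : H →L[ℂ] H :=
  f OnePoint.infty • (1 : H →L[ℂ] H) + π (onePointRestrict f)

/-- The support of an operator on an `X`-module, viewed as a module over the one-point
compactification `X⁺`. -/
def opSupportPlus (π : C₀(X, ℂ) → H →L[ℂ] H) (T : H →L[ℂ] H) :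
    Set (OnePoint X × OnePoint X) :=
  {p | ∀ U V : Set (OnePoint X), IsOpen U → IsOpen V → p.2 ∈ U → p.1 ∈ V →
      ∃ f g : C(OnePoint X, ℂ), tsupport ⇑f ⊆ U ∧ tsupport ⇑g ⊆ V ∧
        (onePointAct π g).comp (T.comp (onePointAct π f)) ≠ 0}

/-- A family of operators indexed by `[1, ∞)` (modelled on `ℝ`) is bounded in norm. -/
def OpBdd (T : ℝ → H →L[ℂ] H) : Prop :=
  ∃ C : ℝ, ∀ t : ℝ, 1 ≤ t → ‖T t‖ ≤ C

/-- `lim_{t → ∞} ‖[φ, T_t]‖ = 0` for every `φ ∈ C₀(X)`. -/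
def CommDecay (π : C₀(X, ℂ) → H →L[ℂ] H) (T : ℝ → H →L[ℂ] H) : Prop :=
  ∀ φ : C₀(X, ℂ),
    Tendsto (fun t => ‖(π φ).comp (T t) - (T t).comp (π φ)‖) atTop (𝓝 0)

/-- The supports of the `T_t`, viewed in `X⁺ × X⁺`, are eventually contained in any given
open neighbourhood of the diagonal. -/
def SmallSuppPlus (π : C₀(X, ℂ) → H →L[ℂ] H) (S : ℝ → H →L[ℂ] H) : Prop :=
  ∀ U : Set (OnePoint X × OnePoint X), IsOpen U → (∀ z, (z, z) ∈ U) →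
    ∃ tU : ℝ, 1 ≤ tU ∧ ∀ t > tU, opSupportPlus π (S t) ⊆ U

/-- Uniform closure (over `[1, ∞)`, in the sup-norm) of a set of operator-valued
functions; this is the norm closure inside `C_b([1,∞), 𝒦(H))` when applied to sets of
bounded continuous compact-operator valued functions. -/
def UnifClosure (A : Set (ℝ → H →L[ℂ] H)) : Set (ℝ → H →L[ℂ] H) :=
  {T | ∀ ε > (0 : ℝ), ∃ S ∈ A, ∀ t : ℝ, 1 ≤ t → ‖T t - S t‖ ≤ ε}

/-- The ⋆-algebra `RL^{alg}_c(H_X)`: bounded, norm-continuous, compact-operator valued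
functions on `[1, ∞)` with uniform compact support and commutator decay. -/
def RLalg (π : C₀(X, ℂ) → H →L[ℂ] H) : Set (ℝ → H →L[ℂ] H) :=
  {T | OpBdd T ∧ ContinuousOn T (Set.Ici 1) ∧
    (∀ t : ℝ, 1 ≤ t → IsCompactOperator ⇑(T t)) ∧
    (∃ K : Set X, IsCompact K ∧ ∀ t : ℝ, 1 ≤ t → opSupport π (T t) ⊆ K ×ˢ K) ∧
    CommDecay π T}

/-- The representable localization algebra `RL^*_c(H_X)` (as a set of operator-valued
functions on `[1, ∞)`): the uniform closure of `RL^{alg}_c(H_X)`. -/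
def RLc (π : C₀(X, ℂ) → H →L[ℂ] H) : Set (ℝ → H →L[ℂ] H) :=
  UnifClosure (RLalg π)

/-- A metric on a topological space `Z`, compatible with its topology. -/
structure CompatMetric (Z : Type*) [TopologicalSpace Z] where
  d : Z → Z → ℝ
  refl : ∀ z, d z z = 0
  eq_of_d : ∀ {a b : Z}, d a b = 0 → a = b
  symm : ∀ a b, d a b = d b a
  triangle : ∀ a b c, d a c ≤ d a b + d b c
  compat : ∀ s : Set Z, IsOpen s ↔ ∀ z ∈ s, ∃ ε > (0 : ℝ), {w | d z w < ε} ⊆ s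

/-- `prop(T_t) → 0` as `t → ∞`, with respect to a metric `D` on `X⁺` (propagation being
measured via the support in `X⁺ × X⁺`). -/
def PropDecayPlus (π : C₀(X, ℂ) → H →L[ℂ] H) (D : CompatMetric (OnePoint X))
    (S : ℝ → H →L[ℂ] H) : Prop :=
  ∀ ε > (0 : ℝ), ∃ t₀ : ℝ, ∀ t ≥ t₀, ∀ p ∈ opSupportPlus π (S t), D.d p.1 p.2 ≤ ε

/-- A family of operators is continuous for the strong-* operator topology on `[1, ∞)`. -/
def StrongStarContOn (T : ℝ → H →L[ℂ] H) : Prop :=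
  (∀ v : H, ContinuousOn (fun t => T t v) (Set.Ici 1)) ∧
  (∀ v : H, ContinuousOn (fun t => ContinuousLinearMap.adjoint (T t) v) (Set.Ici 1))

open scoped CompactlySupported

/-- A compactly supported function whose support is covered by two open sets splits as a sum of
functions supported in the respective sets. -/
lemma exists_add_eq_of_tsupport_subset_union {Y : Type*} [TopologicalSpace Y] [T2Space Y]
    [LocallyCompactSpace Y] (f : C_c(Y, ℂ)) {U V : Set Y} (hU : IsOpen U) (hV : IsOpen V)
    (h : tsupport f ⊆ U ∪ V) :
    ∃ f₁ f₂ : C_c(Y, ℂ), f = f₁ + f₂ ∧ tsupport f₁ ⊆ U ∧ tsupport f₂ ⊆ V := by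
  obtain ⟨p, hp, hsum, -, -⟩ := exists_continuous_sum_one_of_isOpen_isCompact
    (s := ![U, V]) (by simp [Fin.forall_fin_two, hU, hV]) f.hasCompactSupport
    (by
      intro y hy
      rcases h hy with hy | hy
      · exact Set.mem_iUnion.2 ⟨0, hy⟩
      · exact Set.mem_iUnion.2 ⟨1, hy⟩)
  let q : Fin 2 → C_c(Y, ℂ) := fun i =>
    ⟨⟨fun y => (p i y : ℂ) * f y, by fun_prop⟩, f.hasCompactSupport.mul_left⟩
  have hq : ∀ i, tsupport (q i) ⊆ ![U, V] i := fun i => by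
    refine (closure_mono ?_).trans (hp i)
    intro y hy h0
    apply hy
    change (p i y : ℂ) * f y = 0
    simp [h0]
  refine ⟨q 0, q 1, ?_, hq 0, hq 1⟩
  ext y
  change f y = (p 0 y : ℂ) * f y + (p 1 y : ℂ) * f y
  by_cases hy : y ∈ tsupport f
  · have h1 := hsum hy
    simp only [Fin.sum_univ_two, Pi.one_apply, Pi.add_apply] at h1
    rw [← add_mul, ← Complex.ofReal_add, h1]
    simp
  · simp [image_eq_zero_of_notMem_tsupport hy]

/-- A biadditive condition on pairs of compactly supported functions may be checked locally. -/
lemma biadditive_of_local {Y : Type*} [TopologicalSpace Y] [T2Space Y]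
    [LocallyCompactSpace Y] {P : C_c(Y, ℂ) → C_c(Y, ℂ) → Prop}
    (add_left : ∀ f₁ f₂ g, P f₁ g → P f₂ g → P (f₁ + f₂) g)
    (add_right : ∀ f g₁ g₂, P f g₁ → P f g₂ → P f (g₁ + g₂))
    (zero_left : ∀ g, P 0 g) (zero_right : ∀ f, P f 0) {f g : C_c(Y, ℂ)}
    (h : ∀ x ∈ tsupport f, ∀ y ∈ tsupport g, ∃ U V : Set Y, IsOpen U ∧ IsOpen V ∧ x ∈ U ∧ y ∈ V ∧
      ∀ f' g' : C_c(Y, ℂ), tsupport f' ⊆ U → tsupport g' ⊆ V → P f' g') : P f g := by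
  have eq_zero : ∀ f : C_c(Y, ℂ), tsupport f ⊆ ∅ → f = 0 := fun f hf => by
    ext y
    exact image_eq_zero_of_notMem_tsupport fun hy => hf hy
  have step : ∀ x ∈ tsupport f, ∃ U V : Set Y, IsOpen U ∧ IsOpen V ∧ x ∈ U ∧ tsupport g ⊆ V ∧
      ∀ f' g' : C_c(Y, ℂ), tsupport f' ⊆ U → tsupport g' ⊆ V → P f' g' := by
    intro x hx
    refine g.hasCompactSupport.isCompact.induction_on
      (p := fun s => ∃ U V : Set Y, IsOpen U ∧ IsOpen V ∧ x ∈ U ∧ s ⊆ V ∧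
        ∀ f' g' : C_c(Y, ℂ), tsupport f' ⊆ U → tsupport g' ⊆ V → P f' g') ?_ ?_ ?_ ?_
    · exact ⟨Set.univ, ∅, isOpen_univ, isOpen_empty, trivial, le_rfl, fun f' g' _ hg => by
        rw [eq_zero g' hg]; exact zero_right _⟩
    · rintro s t hst ⟨U, V, hU, hV, hxU, htV, hP⟩
      exact ⟨U, V, hU, hV, hxU, hst.trans htV, hP⟩
    · rintro s t ⟨U, V, hU, hV, hxU, hsV, hP⟩ ⟨U', V', hU', hV', hxU', htV', hP'⟩
      refine ⟨U ∩ U', V ∪ V', hU.inter hU', hV.union hV', ⟨hxU, hxU'⟩,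
        Set.union_subset_union hsV htV', fun f' g' hf hg => ?_⟩
      obtain ⟨g₁, g₂, rfl, h₁, h₂⟩ := exists_add_eq_of_tsupport_subset_union g' hV hV' hg
      exact add_right _ _ _ (hP _ _ (hf.trans Set.inter_subset_left) h₁)
        (hP' _ _ (hf.trans Set.inter_subset_right) h₂)
    · intro y hy
      obtain ⟨U, V, hU, hV, hxU, hyV, hP⟩ := h x hx y hy
      exact ⟨V, mem_nhdsWithin_of_mem_nhds (hV.mem_nhds hyV), U, V, hU, hV, hxU, le_rfl, hP⟩
  suffices H : ∃ U : Set Y, IsOpen U ∧ tsupport f ⊆ U ∧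
      ∀ f' : C_c(Y, ℂ), tsupport f' ⊆ U → P f' g by
    obtain ⟨U, -, hfU, hP⟩ := H
    exact hP f hfU
  refine f.hasCompactSupport.isCompact.induction_on
    (p := fun s => ∃ U : Set Y, IsOpen U ∧ s ⊆ U ∧
      ∀ f' : C_c(Y, ℂ), tsupport f' ⊆ U → P f' g) ?_ ?_ ?_ ?_
  · exact ⟨∅, isOpen_empty, le_rfl, fun f' hf => by rw [eq_zero f' hf]; exact zero_left _⟩
  · rintro s t hst ⟨U, hU, htU, hP⟩
    exact ⟨U, hU, hst.trans htU, hP⟩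
  · rintro s t ⟨U, hU, hsU, hP⟩ ⟨U', hU', htU', hP'⟩
    refine ⟨U ∪ U', hU.union hU', Set.union_subset_union hsU htU', fun f' hf => ?_⟩
    obtain ⟨f₁, f₂, rfl, h₁, h₂⟩ := exists_add_eq_of_tsupport_subset_union f' hU hU' hf
    exact add_left _ _ _ (hP _ h₁) (hP' _ h₂)
  · intro x hx
    obtain ⟨U, V, hU, -, hxU, hgV, hP⟩ := step x hx
    exact ⟨U, mem_nhdsWithin_of_mem_nhds (hU.mem_nhds hxU), U, hU, le_rfl,
      fun f' hf => hP f' g hf hgV⟩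

/-- If `B i → B₀` strongly, with the `B i` uniformly bounded, and `S i → S₀` in norm with `S₀`
compact, then `B i * S i → B₀ * S₀` in norm. -/
lemma tendsto_mul_of_isCompactOperator {ι : Type*} {l : Filter ι} {B S : ι → H →L[ℂ] H}
    {B₀ S₀ : H →L[ℂ] H} {C : ℝ} (hC : ∀ᶠ i in l, ‖B i‖ ≤ C)
    (hB : ∀ v, Tendsto (fun i => B i v) l (𝓝 (B₀ v))) (hS : Tendsto S l (𝓝 S₀))
    (hc : IsCompactOperator S₀) : Tendsto (fun i => B i * S i) l (𝓝 (B₀ * S₀)) := by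
  rw [tendsto_iff_norm_sub_tendsto_zero] at hS ⊢
  have hD : Tendsto (fun i => ‖(B i - B₀) * S₀‖) l (𝓝 0) := by
    obtain ⟨K, hK, hKS⟩ := hc.image_closedBall_subset_compact (f := (S₀ : H →ₗ[ℂ] H)) 1
    rw [Metric.tendsto_nhds]
    intro ε hε
    have key : ∀ᶠ i in l, ∀ k ∈ K, ‖(B i - B₀) k‖ < ε / 2 := by
      refine hK.induction_on (p := fun s => ∀ᶠ i in l, ∀ k ∈ s, ‖(B i - B₀) k‖ < ε / 2)
        (by simp) ?_ ?_ ?_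
      · exact fun s t hst h => h.mono fun i hi k hk => hi k (hst hk)
      · intro s t hs ht
        filter_upwards [hs, ht] with i h1 h2 k hk
        exact hk.elim (h1 k) (h2 k)
      · intro k hk
        have hC' : 0 < |C| + ‖B₀‖ + 1 := by positivity
        refine ⟨Metric.ball k (ε / 4 / (|C| + ‖B₀‖ + 1)),
          mem_nhdsWithin_of_mem_nhds (Metric.ball_mem_nhds _ (by positivity)), ?_⟩
        have h1 := tendsto_iff_norm_sub_tendsto_zero.1 (hB k)
        filter_upwards [hC, h1.eventually (gt_mem_nhds (show (0 : ℝ) < ε / 4 by positivity))]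
          with i hi hik k' hk'
        have h2 : ‖B i - B₀‖ ≤ |C| + ‖B₀‖ + 1 :=
          (norm_sub_le _ _).trans (by linarith [le_abs_self C])
        have h3 : ‖(B i - B₀) (k' - k)‖ < ε / 4 := by
          refine ((B i - B₀).le_opNorm _).trans_lt ?_
          rw [Metric.mem_ball, dist_eq_norm, lt_div_iff₀ hC'] at hk'
          calc _ ≤ (|C| + ‖B₀‖ + 1) * ‖k' - k‖ := by gcongr
            _ < _ := by linarith
        have h4 : (B i - B₀) k' = (B i - B₀) (k' - k) + (B i k - B₀ k) := by
          simp only [sub_apply, map_sub]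
          abel
        rw [h4]
        exact (norm_add_le _ _).trans_lt (by linarith)
    filter_upwards [key] with i hi
    rw [dist_zero_right, norm_norm]
    refine lt_of_le_of_lt (ContinuousLinearMap.opNorm_le_of_unit_norm (C := ε / 2)
      (by positivity) fun x hx => ?_) (by linarith)
    exact (hi _ (hKS ⟨x, by simp [hx], rfl⟩)).le
  have hlim : Tendsto (fun i => |C| * ‖S i - S₀‖ + ‖(B i - B₀) * S₀‖) l (𝓝 0) := by
    simpa using (hS.const_mul |C|).add hD
  refine squeeze_zero' (Eventually.of_forall fun _ => norm_nonneg _) ?_ hlim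
  filter_upwards [hC] with i hi
  have : B i * S i - B₀ * S₀ = B i * (S i - S₀) + (B i - B₀) * S₀ := by noncomm_ring
  rw [this]
  refine (norm_add_le _ _).trans (add_le_add_left ((norm_mul_le _ _).trans ?_) _)
  gcongr
  exact hi.trans (le_abs_self C)

/-- The adjoint of a compact operator on a Hilbert space is compact. -/
lemma isCompactOperator_adjoint {S : H →L[ℂ] H} (hS : IsCompactOperator S) :
    IsCompactOperator (ContinuousLinearMap.adjoint S) := by
  set R := ContinuousLinearMap.adjoint S with hR
  have hSR : IsCompactOperator (S.comp R : H →ₗ[ℂ] H) := hS.comp_clm R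
  obtain ⟨K, hK, hSK⟩ := hSR.image_ball_subset_compact 1
  suffices h : TotallyBounded (R '' Metric.ball 0 1) from
    (isCompactOperator_iff_image_ball_subset_compact (R : H →ₗ[ℂ] H) one_pos).2
      ⟨_, h.closure.isCompact_of_isClosed isClosed_closure, subset_closure⟩
  rw [Metric.totallyBounded_iff]
  intro ε hε
  obtain ⟨t, ht, htf, hcov⟩ := Set.exists_subset_image_finite_and.1
    (Metric.finite_approx_of_totallyBounded (hK.totallyBounded.subset hSK) (ε ^ 2 / 2)
      (by positivity))
  refine ⟨R '' t, htf.image _, ?_⟩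
  rintro _ ⟨x, hx, rfl⟩
  obtain ⟨_, ⟨z, hz, rfl⟩, hxz⟩ := Set.mem_iUnion₂.1 (hcov ⟨x, hx, rfl⟩)
  refine Set.mem_iUnion₂.2 ⟨R z, ⟨z, hz, rfl⟩, ?_⟩
  have hz1 := ht hz
  rw [mem_ball_zero_iff] at hx hz1
  rw [Metric.mem_ball, dist_eq_norm, ← map_sub] at hxz ⊢
  have h1 : ‖x - z‖ ≤ 2 := (norm_sub_le _ _).trans (by linarith)
  have h2 : ‖R (x - z)‖ ^ 2 ≤ ‖S (R (x - z))‖ * ‖x - z‖ := by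
    have h3 : inner ℂ (R (x - z)) (R (x - z)) = inner ℂ (S (R (x - z))) (x - z) := by
      rw [hR, ContinuousLinearMap.adjoint_inner_right]
    have h4 := norm_inner_le_norm (𝕜 := ℂ) (S (R (x - z))) (x - z)
    rwa [← h3, inner_self_eq_norm_sq_to_K, norm_pow, RCLike.norm_ofReal, abs_norm] at h4
  have h5 : ‖S (R (x - z))‖ < ε ^ 2 / 2 := hxz
  have h6 : ‖R (x - z)‖ ^ 2 < ε ^ 2 := by
    nlinarith [norm_nonneg (S (R (x - z))), norm_nonneg (x - z)]
  exact lt_of_pow_lt_pow_left₀ 2 hε.le h6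

namespace IsStarRep

variable {π : C₀(X, ℂ) → H →L[ℂ] H}

/-- The ⋆-homomorphism underlying a ⋆-representation. -/
def toHom (hπ : IsStarRep π) : C₀(X, ℂ) →⋆ₙₐ[ℂ] (H →L[ℂ] H) where
  toFun := π
  map_smul' := hπ.map_smul
  map_zero' := by simpa using hπ.map_smul 0 0
  map_add' := hπ.map_add
  map_mul' := hπ.map_mul
  map_star' φ := (hπ.map_star φ).symm

lemma map_zero (hπ : IsStarRep π) : π 0 = 0 := _root_.map_zero hπ.toHom

lemma map_sub (hπ : IsStarRep π) (φ ψ : C₀(X, ℂ)) : π (φ - ψ) = π φ - π ψ :=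
  _root_.map_sub hπ.toHom φ ψ

lemma map_mul' (hπ : IsStarRep π) (φ ψ : C₀(X, ℂ)) : π (φ * ψ) = π φ * π ψ := hπ.map_mul φ ψ

lemma norm_le (hπ : IsStarRep π) (φ : C₀(X, ℂ)) : ‖π φ‖ ≤ ‖φ‖ :=
  NonUnitalStarAlgHom.norm_apply_le hπ.toHom φ

end IsStarRep

/-- A compactly supported continuous function, viewed as a function vanishing at infinity. -/
def compactlySupportedToZeroAtInfty (f : C_c(X, ℂ)) : C₀(X, ℂ) where
  toFun := f
  continuous_toFun := f.continuous
  zero_at_infty' := f.hasCompactSupport.is_zero_at_infty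

lemma norm_zeroAtInfty_le {φ : C₀(X, ℂ)} {C : ℝ} (hC : 0 ≤ C) (h : ∀ x, ‖φ x‖ ≤ C) : ‖φ‖ ≤ C :=
  (BoundedContinuousFunction.norm_le (f := φ.toBCF) hC).2 h

/-- Compactly supported cutoff functions. -/
lemma exists_cutoff [T2Space X] [LocallyCompactSpace X] {K : Set X} (hK : IsCompact K) :
    ∃ e : C_c(X, ℂ), (∀ x, ‖e x‖ ≤ 1) ∧ ∃ U : Set X, IsOpen U ∧ K ⊆ U ∧ Set.EqOn e 1 U := by
  obtain ⟨L, hL, hKL⟩ := exists_compact_superset hK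
  obtain ⟨f, hf1, -, hfc, hf⟩ := exists_continuous_one_zero_of_isCompact hL isClosed_empty
    (Set.disjoint_empty L)
  refine ⟨⟨⟨fun x => (f x : ℂ), by fun_prop⟩, hfc.comp_left Complex.ofReal_zero⟩, fun x => ?_,
    interior L, isOpen_interior, hKL, fun x hx => ?_⟩
  · change ‖(f x : ℂ)‖ ≤ 1
    rw [Complex.norm_real, Real.norm_of_nonneg (hf x).1]
    exact (hf x).2
  · change (f x : ℂ) = 1
    rw [hf1 (interior_subset hx)]
    simp

/-- `C₀(X)` has a contractive approximate unit consisting of compactly supported functions. -/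
lemma exists_approxUnit (X : Type*) [TopologicalSpace X] [T2Space X] [LocallyCompactSpace X] :
    ∃ e : TopologicalSpace.Compacts X → C_c(X, ℂ),
      (∀ K, ‖compactlySupportedToZeroAtInfty (e K)‖ ≤ 1) ∧
      ∀ φ : C₀(X, ℂ), Tendsto (fun K => compactlySupportedToZeroAtInfty (e K) * φ) atTop (𝓝 φ) := by
  choose e he1 U hU hKU he using fun K : TopologicalSpace.Compacts X => exists_cutoff K.isCompact
  refine ⟨e, fun K => norm_zeroAtInfty_le zero_le_one (he1 K), fun φ => ?_⟩
  rw [tendsto_iff_norm_sub_tendsto_zero, Metric.tendsto_nhds]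
  intro ε hε
  have h0 : ∀ᶠ x in cocompact X, ‖φ x‖ < ε / 4 := by
    simpa using (zero_at_infty φ).norm.eventually (gt_mem_nhds (by simpa using by positivity))
  obtain ⟨K, hK, hKφ⟩ := Filter.mem_cocompact.1 h0
  filter_upwards [eventually_ge_atTop (⟨K, hK⟩ : TopologicalSpace.Compacts X)] with L hL
  rw [dist_zero_right, norm_norm]
  refine lt_of_le_of_lt (norm_zeroAtInfty_le (C := ε / 2) (by positivity) fun x => ?_)
    (by linarith)
  change ‖e L x * φ x - φ x‖ ≤ ε / 2
  by_cases hx : x ∈ K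
  · rw [he L (hKU L (hL hx))]
    simp
    positivity
  · have h1 : ‖φ x‖ < ε / 4 := hKφ hx
    calc ‖e L x * φ x - φ x‖ ≤ ‖e L x‖ * ‖φ x‖ + ‖φ x‖ := by
          rw [← norm_mul]
          exact norm_sub_le _ _
      _ ≤ 1 * ‖φ x‖ + ‖φ x‖ := by
          gcongr
          exact he1 L x
      _ ≤ ε / 2 := by linarith

/-- A contractive approximate unit of `C₀(X)` acts strongly as an approximate identity on every
`X`-module. -/
lemma IsStarRep.tendsto_apply {π : C₀(X, ℂ) → H →L[ℂ] H} (hπ : IsStarRep π) {ι : Type*}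
    {l : Filter ι} {e : ι → C₀(X, ℂ)} (he1 : ∀ i, ‖e i‖ ≤ 1)
    (he : ∀ φ, Tendsto (fun i => e i * φ) l (𝓝 φ)) (v : H) :
    Tendsto (fun i => π (e i) v) l (𝓝 v) := by
  have hpe : ∀ i, ‖π (e i)‖ ≤ 1 := fun i => (hπ.norm_le _).trans (he1 i)
  have hspan : ∀ w ∈ Submodule.span ℂ (Set.range fun p : C₀(X, ℂ) × H => π p.1 p.2),
      Tendsto (fun i => π (e i) w) l (𝓝 w) := by
    intro w hw
    induction hw using Submodule.span_induction with
    | mem w hw =>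
      obtain ⟨⟨φ, u⟩, rfl⟩ := hw
      have hc : Continuous hπ.toHom :=
        AddMonoidHomClass.continuous_of_bound hπ.toHom 1 fun φ => by
          simpa using! hπ.norm_le φ
      have h1 : Tendsto (fun i => π (e i * φ)) l (𝓝 (π φ)) := (hc.tendsto φ).comp (he φ)
      have h2 := ((ContinuousLinearMap.apply ℂ H u).continuous.tendsto _).comp h1
      refine h2.congr fun i => ?_
      simp [hπ.map_mul]
    | zero => simpa using tendsto_const_nhds
    | add x y _ _ hx hy => simpa using hx.add hy
    | smul a x _ hx => simpa using hx.const_smul a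
  rw [Metric.tendsto_nhds]
  intro ε hε
  obtain ⟨w, hw, hvw⟩ := hπ.nondeg.exists_dist_lt v (show (0 : ℝ) < ε / 3 by positivity)
  filter_upwards [Metric.tendsto_nhds.1 (hspan w hw) (ε / 3) (by positivity)] with i hi
  have h1 : dist (π (e i) v) (π (e i) w) ≤ dist v w := by
    rw [dist_eq_norm, dist_eq_norm, ← _root_.map_sub]
    simpa using (π (e i)).le_of_opNorm_le (hpe i) (v - w)
  calc dist (π (e i) v) v
      ≤ dist (π (e i) v) (π (e i) w) + dist (π (e i) w) w + dist w v := dist_triangle4 _ _ _ _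
    _ < ε := by rw [dist_comm w v]; linarith

lemma tsupport_star (φ : C₀(X, ℂ)) : tsupport ⇑(star φ) = tsupport ⇑φ := by
  unfold tsupport
  congr 1
  ext x
  simp [Function.mem_support]

section
variable {π : C₀(X, ℂ) → H →L[ℂ] H}

lemma opSupport_adjoint (hπ : IsStarRep π) (S : H →L[ℂ] H) :
    opSupport π (ContinuousLinearMap.adjoint S) ⊆ Prod.swap ⁻¹' opSupport π S := by
  intro p hp U V hU hV hpU hpV
  obtain ⟨φ, ψ, hφ, hψ, hne⟩ := hp V U hV hU hpV hpU
  refine ⟨star ψ, star φ, by rwa [tsupport_star], by rwa [tsupport_star], fun h0 => hne ?_⟩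
  have := congrArg ContinuousLinearMap.adjoint h0
  simpa only [ContinuousLinearMap.adjoint_comp, hπ.map_star, star_star, _root_.map_zero,
    ContinuousLinearMap.comp_assoc] using this

/-- A function equal to `1` near the support of an operator acts on it as the identity. -/
lemma mul_eq_self_of_opSupport_subset [T2Space X] [LocallyCompactSpace X] (hπ : IsStarRep π)
    {S : H →L[ℂ] H} {K U : Set X} (hS : opSupport π S ⊆ K ×ˢ K) (hU : IsOpen U) (hKU : K ⊆ U)
    {χ : C₀(X, ℂ)} (hχ : Set.EqOn χ 1 U) : π χ * S = S := by
  obtain ⟨e, he1, he⟩ := exists_approxUnit X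
  have hlim := hπ.tendsto_apply he1 he
  have hzero : ∀ (α : C_c(X, ℂ)) (β : C_c(X, ℂ)),
      tsupport α ⊆ Uᶜ → π (compactlySupportedToZeroAtInfty α) * S *
        π (compactlySupportedToZeroAtInfty β) = 0 := by
    intro α β hα
    refine biadditive_of_local (P := fun f g => π (compactlySupportedToZeroAtInfty f) * S *
        π (compactlySupportedToZeroAtInfty g) = 0) ?_ ?_ ?_ ?_ ?_
    · intro f₁ f₂ g h₁ h₂
      have : compactlySupportedToZeroAtInfty (f₁ + f₂) =
        compactlySupportedToZeroAtInfty f₁ + compactlySupportedToZeroAtInfty f₂ := rfl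
      rw [this, hπ.map_add, add_mul, add_mul, h₁, h₂, add_zero]
    · intro g f₁ f₂ h₁ h₂
      have : compactlySupportedToZeroAtInfty (f₁ + f₂) =
        compactlySupportedToZeroAtInfty f₁ + compactlySupportedToZeroAtInfty f₂ := rfl
      rw [this, hπ.map_add, mul_add, h₁, h₂, add_zero]
    · intro g
      have : compactlySupportedToZeroAtInfty (0 : C_c(X, ℂ)) = 0 := rfl
      rw [this, hπ.map_zero, zero_mul, zero_mul]
    · intro g
      have : compactlySupportedToZeroAtInfty (0 : C_c(X, ℂ)) = 0 := rfl
      rw [this, hπ.map_zero, mul_zero]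
    · intro x hx y _
      have hxy : (x, y) ∉ opSupport π S := fun h => hα hx (hKU (hS h).1)
      simp only [opSupport, Set.mem_ofPred_eq, not_forall, not_exists, not_and, not_not] at hxy
      obtain ⟨V, W, hV, hW, hyV, hxW, h⟩ := hxy
      refine ⟨W, V, hW, hV, hxW, hyV, fun f g hf hg => ?_⟩
      rw [mul_assoc]
      exact h _ _ hg hf
  ext v
  have h1 : ∀ L v, π χ (π (compactlySupportedToZeroAtInfty (e L)) (S v)) =
      π (compactlySupportedToZeroAtInfty (e L)) (S v) := by
    intro L v
    let α : C_c(X, ℂ) := ⟨⟨fun x => (χ x - 1) * e L x, by fun_prop⟩,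
      (e L).hasCompactSupport.mul_left⟩
    have hα : tsupport α ⊆ Uᶜ := by
      refine closure_minimal (fun x hx hxU => hx ?_) hU.isClosed_compl
      change (χ x - 1) * e L x = 0
      simp [hχ hxU]
    have hαe : compactlySupportedToZeroAtInfty α =
        χ * compactlySupportedToZeroAtInfty (e L) - compactlySupportedToZeroAtInfty (e L) := by
      ext x
      exact (sub_mul _ _ _).trans (by rw [one_mul]; rfl)
    have h2 : ∀ M, π (compactlySupportedToZeroAtInfty α)
        (S (π (compactlySupportedToZeroAtInfty (e M)) v)) = 0 := fun M =>
      congrArg (fun A : H →L[ℂ] H => A v) (hzero α (e M) hα)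
    have h3 := ((π (compactlySupportedToZeroAtInfty α) * S).continuous.tendsto v).comp (hlim v)
    have h4 : π (compactlySupportedToZeroAtInfty α) (S v) = 0 :=
      tendsto_nhds_unique h3 (tendsto_const_nhds.congr fun M => (h2 M).symm)
    rw [hαe, hπ.map_sub, hπ.map_mul] at h4
    exact sub_eq_zero.1 h4
  exact tendsto_nhds_unique (((π χ).continuous.tendsto _).comp (hlim (S v)))
    ((hlim (S v)).congr fun L => (h1 L v).symm)

/-- The support of `π ψ * A * π χ` is contained in the product of the supports. -/
lemma opSupport_mul_mul_subset (hπ : IsStarRep π) (ψ χ : C₀(X, ℂ)) (A : H →L[ℂ] H) :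
    opSupport π (π ψ * A * π χ) ⊆ tsupport ψ ×ˢ tsupport χ := by
  have key : ∀ f g : C₀(X, ℂ), tsupport f ⊆ (tsupport g)ᶜ → f * g = 0 := fun f g h => by
    ext x
    by_cases hx : x ∈ tsupport f
    · simp [image_eq_zero_of_notMem_tsupport (h hx)]
    · simp [image_eq_zero_of_notMem_tsupport hx]
  rintro ⟨y, x⟩ hp
  by_contra hyx
  rw [Set.mem_prod, not_and_or] at hyx
  rcases hyx with hy | hx
  · obtain ⟨f, g, -, hg, hne⟩ := hp Set.univ (tsupport ψ)ᶜ isOpen_univ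
      (isClosed_tsupport _).isOpen_compl trivial hy
    refine hne ?_
    have : π g * π ψ = 0 := by rw [← hπ.map_mul', key g ψ hg, hπ.map_zero]
    change π g * (π ψ * A * π χ * π f) = 0
    simp only [← mul_assoc, this, zero_mul]
  · obtain ⟨f, g, hf, -, hne⟩ := hp (tsupport χ)ᶜ Set.univ
      (isClosed_tsupport _).isOpen_compl isOpen_univ hx trivial
    refine hne ?_
    have : π χ * π f = 0 := by rw [← hπ.map_mul', mul_comm, key f χ hf, hπ.map_zero]
    change π g * (π ψ * A * π χ * π f) = 0
    simp only [mul_assoc, this, mul_zero]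

lemma CommDecay.adjoint (hπ : IsStarRep π) {S : ℝ → H →L[ℂ] H} (hS : CommDecay π S) :
    CommDecay π fun t => ContinuousLinearMap.adjoint (S t) := by
  intro φ
  refine (hS (star φ)).congr fun t => ?_
  rw [← LinearIsometryEquiv.norm_map ContinuousLinearMap.adjoint, norm_sub_rev]
  simp only [_root_.map_sub, ContinuousLinearMap.adjoint_comp, hπ.map_star, star_star]

lemma OpBdd.adjoint {S : ℝ → H →L[ℂ] H} (hS : OpBdd S) :
    OpBdd fun t => ContinuousLinearMap.adjoint (S t) := by
  obtain ⟨C, hC⟩ := hS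
  exact ⟨C, fun t ht => by simpa using hC t ht⟩

/-- The representable localization algebra is closed under adjoints. -/
lemma RLc_adjoint (hπ : IsStarRep π) {S : ℝ → H →L[ℂ] H} (hS : S ∈ RLc π) :
    (fun t => ContinuousLinearMap.adjoint (S t)) ∈ RLc π := by
  intro ε hε
  obtain ⟨R, ⟨hb, hcont, hc, ⟨K, hK, hKR⟩, hcd⟩, hSR⟩ := hS ε hε
  refine ⟨fun t => ContinuousLinearMap.adjoint (R t), ⟨hb.adjoint,
    ContinuousLinearMap.adjoint.continuous.comp_continuousOn hcont,
    fun t ht => isCompactOperator_adjoint (hc t ht), ⟨K, hK, fun t ht p hp => ?_⟩,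
    hcd.adjoint hπ⟩, fun t ht => ?_⟩
  · exact (hKR t ht (opSupport_adjoint hπ _ hp)).symm
  · rw [← _root_.map_sub, LinearIsometryEquiv.norm_map]
    exact hSR t ht

end

/-- Left multiplication by a bounded, strongly continuous, asymptotically commuting family
preserves the representable localization algebra. -/
lemma mul_mem_RLc [T2Space X] [LocallyCompactSpace X] {π : C₀(X, ℂ) → H →L[ℂ] H}
    (hπ : IsStarRep π) {T : ℝ → H →L[ℂ] H} (hTb : OpBdd T)
    (hTc : ∀ v : H, ContinuousOn (fun t => T t v) (Set.Ici 1)) (hT : CommDecay π T)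
    {S : ℝ → H →L[ℂ] H} (hS : S ∈ RLc π) : (fun t => (T t).comp (S t)) ∈ RLc π := by
  intro ε hε
  obtain ⟨C, hC⟩ := hTb
  have hC0 : 0 ≤ C := (norm_nonneg _).trans (hC 1 le_rfl)
  obtain ⟨R, ⟨⟨D, hD⟩, hRcont, hRc, ⟨K, hK, hKR⟩, hRcd⟩, hSR⟩ :=
    hS (ε / 2 / (C + 1)) (by positivity)
  have hD0 : 0 ≤ D := (norm_nonneg _).trans (hD 1 le_rfl)
  obtain ⟨χ', -, U, hU, hKU, hχ'⟩ := exists_cutoff hK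
  set χ := compactlySupportedToZeroAtInfty χ'
  have hχc : IsCompact (tsupport χ) := χ'.hasCompactSupport
  have hχR : ∀ t, 1 ≤ t → π χ * R t = R t := fun t ht =>
    mul_eq_self_of_opSupport_subset hπ (hKR t ht) hU hKU hχ'
  have hRχ : ∀ t, 1 ≤ t → R t * π (star χ) = R t := by
    intro t ht
    have h1 : π χ * ContinuousLinearMap.adjoint (R t) = ContinuousLinearMap.adjoint (R t) :=
      mul_eq_self_of_opSupport_subset hπ
        (fun p hp => (hKR t ht (opSupport_adjoint hπ _ hp)).symm) hU hKU hχ'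
    have h2 := congrArg ContinuousLinearMap.adjoint h1
    rw [ContinuousLinearMap.mul_def, ContinuousLinearMap.adjoint_comp, hπ.map_star,
      ContinuousLinearMap.adjoint_adjoint] at h2
    exact h2
  have hTRcont : ContinuousOn (fun t => T t * R t) (Set.Ici 1) := fun t ht =>
    tendsto_mul_of_isCompactOperator
      (eventually_nhdsWithin_of_forall fun s hs => hC s hs)
      (fun v => hTc v t ht) (hRcont t ht) (hRc t ht)
  have hTRc : ∀ t, 1 ≤ t → IsCompactOperator (T t * R t) := fun t ht => (hRc t ht).clm_comp (T t)
  obtain ⟨e, he1, he⟩ := exists_approxUnit X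
  have hpe : ∀ L, ‖π (compactlySupportedToZeroAtInfty (e L))‖ ≤ 1 := fun L =>
    (hπ.norm_le _).trans (he1 L)
  obtain ⟨t₀, ht₀⟩ : ∃ t₀ : ℝ, ∀ t ≥ t₀, ‖π χ * T t - T t * π χ‖ < ε / 8 / (D + 1) := by
    exact eventually_atTop.1 ((hT χ).eventually (gt_mem_nhds (by positivity)))
  have hlocal : ∀ᶠ L in atTop, ∀ t ∈ Set.Icc 1 t₀,
      ‖π (compactlySupportedToZeroAtInfty (e L)) * (T t * R t) - T t * R t‖ < ε / 2 := by
    have hunif : TendstoLocallyUniformlyOn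
        (fun L t => π (compactlySupportedToZeroAtInfty (e L)) * (T t * R t))
        (fun t => T t * R t) atTop (Set.Icc 1 t₀) := by
      rw [tendstoLocallyUniformlyOn_iff_forall_tendsto]
      intro t ht
      have hF : Tendsto (fun y : TopologicalSpace.Compacts X × ℝ => T y.2 * R y.2)
          (atTop ×ˢ 𝓝[Set.Icc 1 t₀] t) (𝓝 (T t * R t)) :=
        ((hTRcont t ht.1).mono Set.Icc_subset_Ici_self).tendsto.comp tendsto_snd
      have hB := tendsto_mul_of_isCompactOperator (l := atTop ×ˢ 𝓝[Set.Icc 1 t₀] t)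
        (B := fun y => π (compactlySupportedToZeroAtInfty (e y.1))) (B₀ := 1)
        (Eventually.of_forall fun y => hpe y.1)
        (fun v => (hπ.tendsto_apply he1 he v).comp tendsto_fst) hF (hTRc t ht.1)
      rw [one_mul] at hB
      exact (hF.prodMk_nhds hB).mono_right (nhds_le_uniformity _)
    have := (tendstoLocallyUniformlyOn_iff_tendstoUniformlyOn_of_compact isCompact_Icc).1 hunif
    filter_upwards [Metric.tendstoUniformlyOn_iff.1 this (ε / 2) (by positivity)] with L hL t ht
    rw [← dist_eq_norm, dist_comm]
    exact hL t ht
  have hχe := (tendsto_iff_norm_sub_tendsto_zero.1 (he χ)).eventually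
    (gt_mem_nhds (show 0 < ε / 4 / (C * D + 1) by positivity))
  obtain ⟨L, hL1, hL2⟩ := (hlocal.and hχe).exists
  set ψ := compactlySupportedToZeroAtInfty (e L)
  have hψ1 : ‖π ψ‖ ≤ 1 := hpe L
  have happrox : ∀ t, 1 ≤ t → ‖π ψ * (T t * R t) - T t * R t‖ ≤ ε / 2 := by
    intro t ht
    by_cases htt : t ≤ t₀
    · exact (hL1 t ⟨ht, htt⟩).le
    have h1 : π ψ * (T t * R t) - T t * R t =
        π (ψ * χ - χ) * (T t * R t) - (π ψ - 1) * ((π χ * T t - T t * π χ) * R t) := by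
      have h2 : T t * R t = T t * π χ * R t := by rw [mul_assoc, hχR t ht]
      calc π ψ * (T t * R t) - T t * R t = (π ψ - 1) * (T t * R t) := by noncomm_ring
        _ = (π ψ - 1) * (T t * π χ * R t) := by rw [h2]
        _ = _ := by rw [hπ.map_sub, hπ.map_mul']; noncomm_ring
    have h3 : ‖π (ψ * χ - χ) * (T t * R t)‖ ≤ ε / 4 := by
      calc _ ≤ ‖π (ψ * χ - χ)‖ * (‖T t‖ * ‖R t‖) :=
            (norm_mul_le _ _).trans (by gcongr; exact norm_mul_le _ _)
        _ ≤ ε / 4 / (C * D + 1) * (C * D) := by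
            gcongr
            · exact (hπ.norm_le _).trans hL2.le
            · exact hC t ht
            · exact hD t ht
        _ ≤ ε / 4 / (C * D + 1) * (C * D + 1) := by gcongr; linarith
        _ = ε / 4 := by field_simp
    have h4 : ‖(π ψ - 1) * ((π χ * T t - T t * π χ) * R t)‖ ≤ ε / 4 := by
      have h5 : ‖π ψ - 1‖ ≤ 2 :=
        (norm_sub_le _ _).trans (by linarith [ContinuousLinearMap.norm_id_le (𝕜 := ℂ) (E := H),
          show ‖(1 : H →L[ℂ] H)‖ ≤ 1 from ContinuousLinearMap.norm_id_le])
      calc _ ≤ ‖π ψ - 1‖ * (‖π χ * T t - T t * π χ‖ * ‖R t‖) :=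
            (norm_mul_le _ _).trans (by gcongr; exact norm_mul_le _ _)
        _ ≤ 2 * (ε / 8 / (D + 1) * D) := by
            gcongr
            · exact (ht₀ t (not_le.1 htt).le).le
            · exact hD t ht
        _ ≤ 2 * (ε / 8 / (D + 1) * (D + 1)) := by gcongr; linarith
        _ = ε / 4 := by field_simp; norm_num
    rw [h1]
    exact (norm_sub_le _ _).trans (by linarith)
  refine ⟨fun t => π ψ * (T t * R t), ⟨⟨1 * (C * D), fun t ht => ?_⟩,
    hTRcont.const_mul _, fun t ht => (hTRc t ht).clm_comp (π ψ),
    ⟨tsupport ψ ∪ tsupport ⇑(star χ), ?_, fun t ht => ?_⟩, fun φ => ?_⟩, fun t ht => ?_⟩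
  · refine (norm_mul_le _ _).trans ?_
    gcongr
    refine (norm_mul_le _ _).trans ?_
    gcongr
    · exact hC t ht
    · exact hD t ht
  · rw [tsupport_star]
    exact (e L).hasCompactSupport.isCompact.union hχc
  · change opSupport π (π ψ * (T t * R t)) ⊆ _
    rw [← hRχ t ht, ← mul_assoc (T t), ← mul_assoc (π ψ)]
    exact (opSupport_mul_mul_subset hπ _ _ _).trans
      (Set.prod_mono Set.subset_union_left Set.subset_union_right)
  · have hlim : Tendsto (fun t => ‖π φ * T t - T t * π φ‖ * D + C * ‖π φ * R t - R t * π φ‖) atTop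
        (𝓝 0) := by
      simpa using! ((hT φ).mul_const D).add ((hRcd φ).const_mul C)
    refine squeeze_zero' (Eventually.of_forall fun _ => norm_nonneg _) ?_ hlim
    filter_upwards [eventually_ge_atTop 1] with t ht
    have hcomm : π φ * π ψ = π ψ * π φ := by rw [← hπ.map_mul', mul_comm, hπ.map_mul']
    have h1 : π φ * (π ψ * (T t * R t)) - π ψ * (T t * R t) * π φ =
        π ψ * ((π φ * T t - T t * π φ) * R t + T t * (π φ * R t - R t * π φ)) := by
      rw [← mul_assoc, hcomm]
      noncomm_ring
    change ‖π φ * (π ψ * (T t * R t)) - π ψ * (T t * R t) * π φ‖ ≤ _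
    rw [h1]
    refine (norm_mul_le _ _).trans ((mul_le_of_le_one_left (norm_nonneg _) hψ1).trans ?_)
    refine (norm_add_le _ _).trans (add_le_add ?_ ?_)
    · refine (norm_mul_le _ _).trans ?_
      gcongr
      exact hD t ht
    · refine (norm_mul_le _ _).trans ?_
      gcongr
      exact hC t ht
  · have h1 : T t * S t - π ψ * (T t * R t) =
        T t * (S t - R t) - (π ψ * (T t * R t) - T t * R t) := by noncomm_ring
    change ‖T t * S t - π ψ * (T t * R t)‖ ≤ ε
    rw [h1]
    have h2 : ‖T t * (S t - R t)‖ ≤ ε / 2 := by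
      calc _ ≤ ‖T t‖ * ‖S t - R t‖ := norm_mul_le _ _
        _ ≤ C * (ε / 2 / (C + 1)) := by
            gcongr
            · exact hC t ht
            · exact hSR t ht
        _ ≤ (C + 1) * (ε / 2 / (C + 1)) := by gcongr; linarith
        _ = ε / 2 := by field_simp
    exact (norm_sub_le _ _).trans (by linarith [happrox t ht])

/-- Both one-sided products with a bounded, strong-* continuous, asymptotically commuting family
preserve the representable localization algebra. -/
lemma multiplier_RLc [T2Space X] [LocallyCompactSpace X] {π : C₀(X, ℂ) → H →L[ℂ] H}
    (hπ : IsStarRep π) {T : ℝ → H →L[ℂ] H} (hTb : OpBdd T) (hTc : StrongStarContOn T)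
    (hT : CommDecay π T) {S : ℝ → H →L[ℂ] H} (hS : S ∈ RLc π) :
    (fun t => (T t).comp (S t)) ∈ RLc π ∧ (fun t => (S t).comp (T t)) ∈ RLc π := by
  refine ⟨mul_mem_RLc hπ hTb hTc.1 hT hS, ?_⟩
  have := RLc_adjoint hπ
    (mul_mem_RLc hπ hTb.adjoint hTc.2 (hT.adjoint hπ) (RLc_adjoint hπ hS))
  simpa only [ContinuousLinearMap.adjoint_comp, ContinuousLinearMap.adjoint_adjoint] using this

section Commutator

variable {Z : Type*} [TopologicalSpace Z]

/-- The complexification of a real-valued continuous function. -/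
def complexify (u : C(Z, ℝ)) : C(Z, ℂ) := ⟨fun z => (u z : ℂ), by fun_prop⟩

/-- The truncation of a real number to `[0, 1]`. -/
def clampUnit (s : ℝ) : ℝ := max 0 (min 1 s)

lemma continuous_clampUnit : Continuous clampUnit := by unfold clampUnit; fun_prop

lemma clampUnit_nonneg (s : ℝ) : 0 ≤ clampUnit s := le_max_left _ _

lemma clampUnit_le_one (s : ℝ) : clampUnit s ≤ 1 := max_le zero_le_one (min_le_left _ _)

lemma clampUnit_mono : Monotone clampUnit := fun s t h => by unfold clampUnit; gcongr

lemma clampUnit_of_nonpos {s : ℝ} (h : s ≤ 0) : clampUnit s = 0 :=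
  max_eq_left ((min_le_right _ _).trans h)

lemma clampUnit_of_one_le {s : ℝ} (h : 1 ≤ s) : clampUnit s = 1 := by simp [clampUnit, h]

/-- The hat functions of `u` around the integers. -/
def hat (u : C(Z, ℝ)) (j : ℕ) : C(Z, ℝ) where
  toFun z := clampUnit (u z - j + 1) - clampUnit (u z - j)
  continuous_toFun := by
    have := continuous_clampUnit
    fun_prop

/-- A cutoff function equal to `1` where `|u - j| ≤ 2` and vanishing where `|u - j| ≥ 3`. -/
def plateau (u : C(Z, ℝ)) (j : ℕ) : C(Z, ℝ) where
  toFun z := clampUnit (3 - |u z - j|)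
  continuous_toFun := by
    have := continuous_clampUnit
    fun_prop

lemma hat_nonneg (u : C(Z, ℝ)) (j : ℕ) (z : Z) : 0 ≤ hat u j z :=
  sub_nonneg.2 (clampUnit_mono (by linarith))

lemma hat_le_one (u : C(Z, ℝ)) (j : ℕ) (z : Z) : hat u j z ≤ 1 :=
  (sub_le_self _ (clampUnit_nonneg _)).trans (clampUnit_le_one _)

lemma hat_eq_zero {u : C(Z, ℝ)} {j : ℕ} {z : Z} (h : 1 < |u z - j|) : hat u j z = 0 := by
  change clampUnit _ - clampUnit _ = 0
  rcases lt_abs.1 h with h | h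
  · rw [clampUnit_of_one_le (by linarith), clampUnit_of_one_le (by linarith), sub_self]
  · rw [clampUnit_of_nonpos (by linarith), clampUnit_of_nonpos (by linarith), sub_self]

lemma sum_hat {u : C(Z, ℝ)} {N : ℕ} {z : Z} (h0 : 0 ≤ u z) (hN : u z ≤ N) :
    ∑ j ∈ Finset.range (N + 1), hat u j z = 1 := by
  have h : ∀ j : ℕ, hat u j z =
      clampUnit (u z - j + 1) - clampUnit (u z - (j + 1 : ℕ) + 1) := fun j => by
    change clampUnit _ - clampUnit _ = _
    congr 2
    push_cast
    ring
  rw [Finset.sum_congr rfl fun j _ => h j,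
    Finset.sum_range_sub' fun j : ℕ => clampUnit (u z - j + 1), clampUnit_of_one_le (by simpa),
    clampUnit_of_nonpos (by push_cast; linarith), sub_zero]

lemma disjoint_tsupport_hat_plateau (u : C(Z, ℝ)) (j : ℕ) :
    Disjoint (tsupport (complexify (hat u j))) (tsupport ⇑(1 - complexify (plateau u j))) := by
  have h1 : tsupport (complexify (hat u j)) ⊆ {z | |u z - j| ≤ 1} := by
    refine closure_minimal (fun z hz => ?_) (isClosed_le (by fun_prop) continuous_const)
    by_contra h
    refine hz ?_
    change ((hat u j z : ℝ) : ℂ) = 0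
    rw [hat_eq_zero (not_le.1 h), Complex.ofReal_zero]
  have h2 : tsupport ⇑(1 - complexify (plateau u j)) ⊆ {z | 2 ≤ |u z - j|} := by
    refine closure_minimal (fun z hz => ?_) (isClosed_le continuous_const (by fun_prop))
    by_contra h
    refine hz ?_
    change 1 - ((clampUnit (3 - |u z - j|) : ℝ) : ℂ) = 0
    have h : |u z - j| < 2 := not_le.1 h
    rw [clampUnit_of_one_le (by linarith), Complex.ofReal_one, sub_self]
  refine Set.disjoint_of_subset h1 h2 (Set.disjoint_left.2 fun z hz hz' => ?_)
  have hz : |u z - j| ≤ 1 := hz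
  have hz' : 2 ≤ |u z - j| := hz'
  linarith

lemma sum_plateau_le (u : C(Z, ℝ)) (s : Finset ℕ) (z : Z) :
    ∑ j ∈ s, ((u z - j) * plateau u j z) ^ 2 ≤ 8 ^ 2 := by
  have hle : ∀ j ∈ s, ((u z - j) * plateau u j z) ^ 2 ≤ if |u z - j| < 3 then 9 else 0 := by
    intro j _
    split_ifs with h
    · have h1 : |(u z - j) * plateau u j z| ≤ 3 * 1 := by
        have hp : 0 ≤ plateau u j z := clampUnit_nonneg _
        rw [abs_mul, abs_of_nonneg hp]
        gcongr
        exact clampUnit_le_one _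
      calc _ = |(u z - j) * plateau u j z| ^ 2 := (sq_abs _).symm
        _ ≤ (3 * 1) ^ 2 := by gcongr
        _ = 9 := by norm_num
    · have : plateau u j z = 0 := clampUnit_of_nonpos (by linarith)
      simp [this]
  refine (Finset.sum_le_sum hle).trans ?_
  rw [← Finset.sum_filter, Finset.sum_const, nsmul_eq_mul]
  have hsub : s.filter (fun j : ℕ => |u z - j| < 3) ⊆ Finset.Icc ⌈u z - 3⌉₊ ⌊u z + 3⌋₊ := by
    intro j hj
    have hj := abs_lt.1 (Finset.mem_filter.1 hj).2
    exact Finset.mem_Icc.2 ⟨Nat.ceil_le.2 (by linarith), Nat.le_floor (by linarith)⟩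
  have hcard : (Finset.Icc ⌈u z - 3⌉₊ ⌊u z + 3⌋₊).card ≤ 7 := by
    rw [Nat.card_Icc]
    by_cases h : 0 ≤ u z + 3
    · have h1 : (⌊u z + 3⌋₊ : ℝ) ≤ ⌈u z - 3⌉₊ + 6 :=
        (Nat.floor_le h).trans (by linarith [Nat.le_ceil (u z - 3)])
      have h2 : ⌊u z + 3⌋₊ ≤ ⌈u z - 3⌉₊ + 6 := by exact_mod_cast h1
      omega
    · rw [Nat.floor_of_nonpos (not_le.1 h).le]
      omega
  have h7 : ((s.filter (fun j : ℕ => |u z - j| < 3)).card : ℝ) ≤ 7 := by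
    exact_mod_cast (Finset.card_le_card hsub).trans hcard
  linarith

variable [CompactSpace Z]

lemma sum_norm_sq_apply_le (ρ : C(Z, ℂ) →⋆ₐ[ℂ] (H →L[ℂ] H)) {ι : Type*} (s : Finset ι)
    (b : ι → C(Z, ℂ)) {B : ℝ} (hb : ∀ z, ∑ i ∈ s, ‖b i z‖ ^ 2 ≤ B ^ 2) (v : H) :
    ∑ i ∈ s, ‖ρ (b i) v‖ ^ 2 ≤ B ^ 2 * ‖v‖ ^ 2 := by
  have h1 : ∑ i ∈ s, ‖ρ (b i) v‖ ^ 2 =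
      RCLike.re (inner ℂ (ρ (∑ i ∈ s, star (b i) * b i) v) v) := by
    rw [map_sum, sum_apply, sum_inner, map_sum]
    refine Finset.sum_congr rfl fun i _ => ?_
    rw [ContinuousLinearMap.apply_norm_sq_eq_inner_adjoint_left, map_mul, map_star,
      ContinuousLinearMap.star_eq_adjoint]
    rfl
  have h2 : ‖∑ i ∈ s, star (b i) * b i‖ ≤ B ^ 2 := by
    refine (ContinuousMap.norm_le _ (sq_nonneg B)).2 fun z => ?_
    rw [ContinuousMap.sum_apply]
    refine (norm_sum_le _ _).trans (le_trans (Finset.sum_le_sum fun i _ => ?_) (hb z))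
    simp [sq]
  rw [h1]
  calc _ ≤ ‖inner ℂ (ρ (∑ i ∈ s, star (b i) * b i) v) v‖ := RCLike.re_le_norm _
    _ ≤ ‖ρ (∑ i ∈ s, star (b i) * b i) v‖ * ‖v‖ := norm_inner_le_norm _ _
    _ ≤ (B ^ 2 * ‖v‖) * ‖v‖ := by
        gcongr
        exact (ρ (∑ i ∈ s, star (b i) * b i)).le_of_opNorm_le
          ((NonUnitalStarAlgHom.norm_apply_le ρ _).trans h2) v
    _ = _ := by ring

/-- A row-column estimate for operators of the form `∑ i, ρ (a i) * T * ρ (b i)`. -/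
lemma norm_sum_mul_mul_le (ρ : C(Z, ℂ) →⋆ₐ[ℂ] (H →L[ℂ] H)) {ι : Type*} (s : Finset ι)
    (a b : ι → C(Z, ℂ)) {A B : ℝ} (hA : 0 ≤ A) (hB : 0 ≤ B)
    (ha : ∀ z, ∑ i ∈ s, ‖a i z‖ ^ 2 ≤ A ^ 2) (hb : ∀ z, ∑ i ∈ s, ‖b i z‖ ^ 2 ≤ B ^ 2)
    (T : H →L[ℂ] H) : ‖∑ i ∈ s, ρ (a i) * T * ρ (b i)‖ ≤ A * B * ‖T‖ := by
  have hsum : ∀ v w : H, ‖inner ℂ w ((∑ i ∈ s, ρ (a i) * T * ρ (b i)) v)‖ ≤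
      ‖w‖ * (A * B * ‖T‖ * ‖v‖) := by
    intro v w
    have hw := sum_norm_sq_apply_le ρ s (fun i => star (a i)) (B := A) (by simpa using ha) w
    have hv := sum_norm_sq_apply_le ρ s b hb v
    have h1 : ∀ i ∈ s, ‖inner ℂ w ((ρ (a i) * T * ρ (b i)) v)‖ ≤
        ‖T‖ * (‖ρ (star (a i)) w‖ * ‖ρ (b i) v‖) := by
      intro i _
      have h2 : inner ℂ w ((ρ (a i) * T * ρ (b i)) v) =
          inner ℂ (ρ (star (a i)) w) (T (ρ (b i) v)) := by
        rw [map_star, ContinuousLinearMap.star_eq_adjoint, ContinuousLinearMap.adjoint_inner_left]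
        rfl
      rw [h2]
      calc _ ≤ ‖ρ (star (a i)) w‖ * ‖T (ρ (b i) v)‖ := norm_inner_le_norm _ _
        _ ≤ ‖ρ (star (a i)) w‖ * (‖T‖ * ‖ρ (b i) v‖) := by gcongr; exact T.le_opNorm _
        _ = _ := by ring
    rw [sum_apply, inner_sum]
    calc _ ≤ ∑ i ∈ s, ‖T‖ * (‖ρ (star (a i)) w‖ * ‖ρ (b i) v‖) :=
          (norm_sum_le _ _).trans (Finset.sum_le_sum h1)
      _ = ‖T‖ * ∑ i ∈ s, ‖ρ (star (a i)) w‖ * ‖ρ (b i) v‖ := (Finset.mul_sum _ _ _).symm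
      _ ≤ ‖T‖ * (√(∑ i ∈ s, ‖ρ (star (a i)) w‖ ^ 2) * √(∑ i ∈ s, ‖ρ (b i) v‖ ^ 2)) := by
          gcongr
          exact Real.sum_mul_le_sqrt_mul_sqrt _ _ _
      _ ≤ ‖T‖ * (√(A ^ 2 * ‖w‖ ^ 2) * √(B ^ 2 * ‖v‖ ^ 2)) := by gcongr
      _ = _ := by
          rw [← mul_pow, ← mul_pow, Real.sqrt_sq (by positivity), Real.sqrt_sq (by positivity)]
          ring
  refine ContinuousLinearMap.opNorm_le_bound _ (by positivity) fun v => ?_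
  set x := (∑ i ∈ s, ρ (a i) * T * ρ (b i)) v
  have h := hsum v x
  rw [inner_self_eq_norm_sq_to_K, norm_pow, RCLike.norm_ofReal, abs_norm, sq] at h
  rcases (norm_nonneg x).eq_or_lt with h0 | h0
  · rw [← h0]
    positivity
  · exact le_of_mul_le_mul_left h h0

/-- A commutator estimate: if `T` does not connect the regions `|u - j| ≤ 1` and `2 ≤ |u - j|`,
then `‖[u, T]‖` is bounded by a universal multiple of `‖T‖`. -/
lemma norm_commutator_le (ρ : C(Z, ℂ) →⋆ₐ[ℂ] (H →L[ℂ] H)) {u : C(Z, ℝ)} {N : ℕ}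
    (h0 : ∀ z, 0 ≤ u z) (hN : ∀ z, u z ≤ N) {T : H →L[ℂ] H}
    (hT : ∀ j ∈ Finset.range (N + 1),
      ρ (1 - complexify (plateau u j)) * T * ρ (complexify (hat u j)) = 0) :
    ‖ρ (complexify u) * T - T * ρ (complexify u)‖ ≤ 9 * ‖T‖ := by
  set s := Finset.range (N + 1) with hs
  let d : ℕ → C(Z, ℂ) := fun j => complexify u - (j : ℂ) • 1
  let a : ℕ → C(Z, ℂ) := fun j => d j * complexify (plateau u j)
  let b : ℕ → C(Z, ℂ) := fun j => complexify (hat u j)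
  have hsum : ∑ j ∈ s, b j = 1 := by
    ext z
    rw [ContinuousMap.sum_apply]
    change ∑ j ∈ s, ((hat u j z : ℝ) : ℂ) = 1
    rw [← Complex.ofReal_sum, sum_hat (h0 z) (hN z), Complex.ofReal_one]
  have hsumρ : ∑ j ∈ s, ρ (b j) = 1 := by rw [← map_sum, hsum, map_one]
  have hid : ρ (complexify u) * T - T * ρ (complexify u) =
      ∑ j ∈ s, ρ (a j) * T * ρ (b j) - T * ρ (∑ j ∈ s, d j * b j) := by
    have hterm : ∀ j ∈ s, ρ (a j) * T * ρ (b j) - T * ρ (d j * b j) =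
        (ρ (complexify u) * T - T * ρ (complexify u)) * ρ (b j) := by
      intro j hj
      have h1 := hT j hj
      rw [map_sub, map_one, sub_mul, sub_mul, one_mul, sub_eq_zero] at h1
      have h2 : ρ (d j) = ρ (complexify u) - (j : ℂ) • 1 := by
        simp only [d, map_sub, map_smul, map_one]
      simp only [a, map_mul]
      rw [mul_assoc (ρ (d j)), mul_assoc (ρ (d j)), ← h1, h2]
      simp only [sub_mul, mul_sub, smul_mul_assoc, mul_smul_comm, one_mul, mul_assoc, b]
      abel
    rw [map_sum, Finset.mul_sum, ← Finset.sum_sub_distrib, Finset.sum_congr rfl hterm,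
      ← Finset.mul_sum, hsumρ, mul_one]
  have hb : ∀ z, ∑ j ∈ s, ‖b j z‖ ^ 2 ≤ 1 ^ 2 := by
    intro z
    rw [one_pow, ← sum_hat (h0 z) (hN z)]
    refine Finset.sum_le_sum fun j _ => ?_
    change ‖((hat u j z : ℝ) : ℂ)‖ ^ 2 ≤ _
    rw [Complex.norm_real, Real.norm_of_nonneg (hat_nonneg u j z)]
    nlinarith [hat_nonneg u j z, hat_le_one u j z]
  have hd : ∀ j z, d j z = ((u z - j : ℝ) : ℂ) := fun j z => by
    change (u z : ℂ) - (j : ℂ) * 1 = _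
    push_cast
    ring
  have ha : ∀ z, ∑ j ∈ s, ‖a j z‖ ^ 2 ≤ 8 ^ 2 := by
    intro z
    refine le_trans (Finset.sum_le_sum fun j _ => ?_) (sum_plateau_le u s z)
    change ‖d j z * ((plateau u j z : ℝ) : ℂ)‖ ^ 2 ≤ _
    rw [hd, ← Complex.ofReal_mul, Complex.norm_real, Real.norm_eq_abs, sq_abs]
  have he : ‖∑ j ∈ s, d j * b j‖ ≤ 1 := by
    refine (ContinuousMap.norm_le _ zero_le_one).2 fun z => ?_
    rw [ContinuousMap.sum_apply, ← sum_hat (h0 z) (hN z)]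
    refine (norm_sum_le _ _).trans (Finset.sum_le_sum fun j _ => ?_)
    change ‖d j z * ((hat u j z : ℝ) : ℂ)‖ ≤ _
    rw [hd, ← Complex.ofReal_mul, Complex.norm_real, norm_mul,
      Real.norm_of_nonneg (hat_nonneg u j z), Real.norm_eq_abs]
    by_cases h : 1 < |u z - j|
    · simp [hat_eq_zero h]
    · exact mul_le_of_le_one_left (hat_nonneg u j z) (not_lt.1 h)
  rw [hid]
  have h1 := norm_sum_mul_mul_le ρ s a b (by norm_num) zero_le_one ha hb T
  have h2 : ‖T * ρ (∑ j ∈ s, d j * b j)‖ ≤ ‖T‖ * 1 := (norm_mul_le _ _).trans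
    (by gcongr; exact (NonUnitalStarAlgHom.norm_apply_le ρ _).trans he)
  exact (norm_sub_le _ _).trans (by linarith)

/-- A bounded family of operators which asymptotically does not connect disjoint closed sets
asymptotically commutes with all continuous functions. -/
lemma tendsto_commutator_zero (ρ : C(Z, ℂ) →⋆ₐ[ℂ] (H →L[ℂ] H)) {ι : Type*} {l : Filter ι}
    {T : ι → H →L[ℂ] H} {C : ℝ} (hC : ∀ᶠ t in l, ‖T t‖ ≤ C)
    (hT : ∀ f g : C(Z, ℂ), Disjoint (tsupport f) (tsupport g) →
      ∀ᶠ t in l, ρ g * T t * ρ f = 0) (f : C(Z, ℂ)) :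
    Tendsto (fun t => ρ f * T t - T t * ρ f) l (𝓝 0) := by
  have hreal : ∀ u : C(Z, ℝ), (∀ z, 0 ≤ u z) →
      Tendsto (fun t => ρ (complexify u) * T t - T t * ρ (complexify u)) l (𝓝 0) := by
    intro u hu
    rw [tendsto_zero_iff_norm_tendsto_zero, Metric.tendsto_nhds]
    intro ε hε
    obtain ⟨m, hm⟩ := exists_nat_gt (9 * |C| / ε)
    obtain ⟨N, hN⟩ := exists_nat_ge ‖(m : ℝ) • u‖
    have h1 : ∀ᶠ t in l, ∀ j ∈ Finset.range (N + 1),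
        ρ (1 - complexify (plateau ((m : ℝ) • u) j)) * T t *
          ρ (complexify (hat ((m : ℝ) • u) j)) = 0 :=
      (Finset.eventually_all _).2 fun j _ => hT _ _ (disjoint_tsupport_hat_plateau _ _)
    have hm0 : (0 : ℝ) < m := lt_of_le_of_lt (by positivity) hm
    filter_upwards [hC, h1] with t ht h2
    have h3 := norm_commutator_le ρ (u := (m : ℝ) • u) (N := N)
      (fun z => mul_nonneg hm0.le (hu z))
      (fun z => (le_abs_self _).trans ((ContinuousMap.norm_coe_le_norm ((m : ℝ) • u) z).trans hN))
      h2
    have h4 : complexify ((m : ℝ) • u) = (m : ℂ) • complexify u := by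
      ext z
      change (((m : ℝ) * u z : ℝ) : ℂ) = (m : ℂ) * (u z : ℂ)
      push_cast
      rfl
    rw [h4, map_smul, smul_mul_assoc, mul_smul_comm, ← smul_sub, norm_smul,
      Complex.norm_natCast] at h3
    rw [dist_zero_right, norm_norm]
    rw [div_lt_iff₀ hε] at hm
    have h5 : (m : ℝ) * ‖ρ (complexify u) * T t - T t * ρ (complexify u)‖ < m * ε := by
      linarith [le_abs_self C]
    exact lt_of_mul_lt_mul_left h5 hm0.le
  have hf : f = complexify ⟨fun z => (f z).re + ‖f‖, by fun_prop⟩ +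
      Complex.I • complexify ⟨fun z => (f z).im + ‖f‖, by fun_prop⟩ -
      ((‖f‖ : ℂ) * (1 + Complex.I)) • 1 := by
    ext z
    change f z = (((f z).re + ‖f‖ : ℝ) : ℂ) + Complex.I * (((f z).im + ‖f‖ : ℝ) : ℂ) -
      ((‖f‖ : ℂ) * (1 + Complex.I)) * 1
    conv_lhs => rw [← Complex.re_add_im (f z)]
    push_cast
    ring
  have h1 := hreal ⟨fun z => (f z).re + ‖f‖, by fun_prop⟩ fun z => by
    have := (abs_le.1 ((Complex.abs_re_le_norm (f z)).trans (f.norm_coe_le_norm z))).1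
    change 0 ≤ (f z).re + ‖f‖
    linarith
  have h2 := hreal ⟨fun z => (f z).im + ‖f‖, by fun_prop⟩ fun z => by
    have := (abs_le.1 ((Complex.abs_im_le_norm (f z)).trans (f.norm_coe_le_norm z))).1
    change 0 ≤ (f z).im + ‖f‖
    linarith
  have h3 := h1.add (h2.const_smul Complex.I)
  rw [smul_zero, add_zero] at h3
  refine h3.congr fun t => ?_
  conv_rhs => rw [hf]
  simp only [map_sub, map_add, map_smul, map_one, sub_mul, add_mul, mul_sub, mul_add,
    smul_mul_assoc, mul_smul_comm, one_mul, mul_one, smul_sub]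
  abel

end Commutator

section OnePoint

/-- The canonical action of `C(X⁺, ℂ)` as a unital ⋆-homomorphism. -/
def IsStarRep.onePointHom {π : C₀(X, ℂ) → H →L[ℂ] H} (hπ : IsStarRep π) :
    C(OnePoint X, ℂ) →⋆ₐ[ℂ] (H →L[ℂ] H) where
  toFun := onePointAct π
  map_one' := by
    have h : onePointRestrict (1 : C(OnePoint X, ℂ)) = 0 := by
      ext x
      exact sub_self _
    rw [onePointAct, h, hπ.map_zero, add_zero]
    exact one_smul _ _
  map_mul' f g := by
    have h : onePointRestrict (f * g) = f OnePoint.infty • onePointRestrict g +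
        g OnePoint.infty • onePointRestrict f + onePointRestrict f * onePointRestrict g := by
      ext x
      change f x * g x - f OnePoint.infty * g OnePoint.infty =
        f OnePoint.infty * (g x - g OnePoint.infty) + g OnePoint.infty * (f x - f OnePoint.infty) +
          (f x - f OnePoint.infty) * (g x - g OnePoint.infty)
      ring
    have hmul : π (onePointRestrict f * onePointRestrict g) =
        π (onePointRestrict f) * π (onePointRestrict g) := hπ.map_mul _ _
    simp only [onePointAct, h, hπ.map_add, hπ.map_smul, hmul, ContinuousMap.mul_apply, add_mul,
      mul_add, smul_mul_assoc, mul_smul_comm, one_mul, mul_one, smul_add, mul_smul]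
    rw [smul_comm]
    abel
  map_zero' := by
    have h : onePointRestrict (0 : C(OnePoint X, ℂ)) = 0 := by
      ext x
      exact sub_self _
    rw [onePointAct, h, hπ.map_zero, add_zero]
    exact zero_smul _ _
  map_add' f g := by
    have h : onePointRestrict (f + g) = onePointRestrict f + onePointRestrict g := by
      ext x
      exact add_sub_add_comm _ _ _ _
    simp only [onePointAct, h, hπ.map_add, ContinuousMap.add_apply, add_smul]
    abel
  commutes' c := by
    have h : onePointRestrict (algebraMap ℂ C(OnePoint X, ℂ) c) = 0 := by
      ext x
      exact sub_self _
    rw [onePointAct, h, hπ.map_zero, add_zero, Algebra.algebraMap_eq_smul_one (A := H →L[ℂ] H)]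
    rfl
  map_star' f := by
    have h : onePointRestrict (star f) = star (onePointRestrict f) := by
      ext x
      exact (star_sub _ _).symm
    rw [onePointAct, onePointAct, h, ← hπ.map_star, star_add, star_smul, star_one]
    rfl

/-- Disjoint closed sets, one of which is compact, have positive distance. -/
lemma CompatMetric.exists_pos_le {Z : Type*} [TopologicalSpace Z] (D : CompatMetric Z)
    {F E : Set Z} (hF : IsCompact F) (hE : IsClosed E) (h : Disjoint F E) :
    ∃ δ > 0, ∀ y ∈ F, ∀ x ∈ E, δ ≤ D.d y x := by
  refine hF.induction_on (p := fun s => ∃ δ > 0, ∀ y ∈ s, ∀ x ∈ E, δ ≤ D.d y x)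
    ⟨1, one_pos, by simp⟩ ?_ ?_ ?_
  · rintro s t hst ⟨δ, hδ, ht⟩
    exact ⟨δ, hδ, fun y hy => ht y (hst hy)⟩
  · rintro s t ⟨δ, hδ, hs⟩ ⟨δ', hδ', ht⟩
    refine ⟨min δ δ', lt_min hδ hδ', ?_⟩
    rintro y (hy | hy) x hx
    · exact (min_le_left _ _).trans (hs y hy x hx)
    · exact (min_le_right _ _).trans (ht y hy x hx)
  · intro y hy
    obtain ⟨ε, hε, hball⟩ := (D.compat Eᶜ).1 hE.isOpen_compl y (Set.disjoint_left.1 h hy)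
    have hopen : IsOpen {w | D.d y w < ε / 2} := by
      refine (D.compat _).2 fun z hz => ?_
      have hz : D.d y z < ε / 2 := hz
      refine ⟨ε / 2 - D.d y z, sub_pos.2 hz, fun w hw => ?_⟩
      have hw : D.d z w < ε / 2 - D.d y z := hw
      have := D.triangle y z w
      change D.d y w < ε / 2
      linarith
    refine ⟨{w | D.d y w < ε / 2}, mem_nhdsWithin_of_mem_nhds (hopen.mem_nhds ?_), ε / 2,
      half_pos hε, fun w hw x hx => ?_⟩
    · change D.d y y < ε / 2
      rw [D.refl]
      exact half_pos hε
    · have hw : D.d y w < ε / 2 := hw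
      have hyx : ε ≤ D.d y x := not_lt.1 fun hlt => hball hlt hx
      have := D.triangle y w x
      linarith

variable [T2Space X] [LocallyCompactSpace X]

lemma IsStarRep.onePointAct_mul_mul_eq_zero {π : C₀(X, ℂ) → H →L[ℂ] H} (hπ : IsStarRep π)
    {T : H →L[ℂ] H} {f g : C(OnePoint X, ℂ)}
    (h : Disjoint (tsupport g ×ˢ tsupport f) (opSupportPlus π T)) :
    hπ.onePointHom g * T * hπ.onePointHom f = 0 := by
  let ρ := hπ.onePointHom
  have key : ∀ f' g' : C_c(OnePoint X, ℂ), tsupport f' = tsupport f → tsupport g' = tsupport g →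
      ρ g'.toContinuousMap * T * ρ f'.toContinuousMap = 0 := by
    intro f' g' hf' hg'
    refine biadditive_of_local
      (P := fun f' g' => ρ g'.toContinuousMap * T * ρ f'.toContinuousMap = 0)
      (fun f₁ f₂ g' h₁ h₂ => ?_) (fun f' g₁ g₂ h₁ h₂ => ?_) (fun g' => ?_) (fun f' => ?_)
      fun x hx y hy => ?_
    · have : (f₁ + f₂).toContinuousMap = f₁.toContinuousMap + f₂.toContinuousMap := rfl
      rw [this, _root_.map_add, mul_add, h₁, h₂, add_zero]
    · have : (g₁ + g₂).toContinuousMap = g₁.toContinuousMap + g₂.toContinuousMap := rfl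
      rw [this, _root_.map_add, add_mul, add_mul, h₁, h₂, add_zero]
    · have : (0 : C_c(OnePoint X, ℂ)).toContinuousMap = 0 := rfl
      rw [this, _root_.map_zero, mul_zero]
    · have : (0 : C_c(OnePoint X, ℂ)).toContinuousMap = 0 := rfl
      rw [this, _root_.map_zero, zero_mul, zero_mul]
    · have hp : (y, x) ∉ opSupportPlus π T :=
        Set.disjoint_left.1 h ⟨hg' ▸ hy, hf' ▸ hx⟩
      simp only [opSupportPlus, Set.mem_ofPred_eq, not_forall] at hp
      obtain ⟨U, V, hU, hV, hxU, hyV, hUV⟩ := hp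
      refine ⟨U, V, hU, hV, hxU, hyV, fun f₁ g₁ hf₁ hg₁ => ?_⟩
      by_contra h0
      exact hUV ⟨f₁.toContinuousMap, g₁.toContinuousMap, hf₁, hg₁, fun h1 => h0 h1⟩
  exact key (CompactlySupportedContinuousMap.continuousMapEquiv f)
    (CompactlySupportedContinuousMap.continuousMapEquiv g) rfl rfl

/-- A bounded family of operators whose propagation tends to zero asymptotically commutes with
`C₀(X)`. -/
lemma commDecay_of_propDecayPlus {π : C₀(X, ℂ) → H →L[ℂ] H} (hπ : IsStarRep π)
    (D : CompatMetric (OnePoint X)) {T : ℝ → H →L[ℂ] H} (hb : OpBdd T)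
    (hT : PropDecayPlus π D T) : CommDecay π T := by
  intro φ
  obtain ⟨C, hC⟩ := hb
  let f : C(OnePoint X, ℂ) := OnePoint.continuousMapMk φ.toContinuousMap 0 (by
    rw [coclosedCompact_eq_cocompact]
    exact φ.zero_at_infty')
  have hf : hπ.onePointHom f = π φ := by
    have h : onePointRestrict f = φ := by
      ext x
      exact sub_zero _
    change (0 : ℂ) • (1 : H →L[ℂ] H) + π (onePointRestrict f) = π φ
    rw [h, zero_smul, zero_add]
  have key := tendsto_commutator_zero hπ.onePointHom (l := atTop) (T := T)
    ((eventually_ge_atTop 1).mono hC) (fun f g hfg => ?_) f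
  · rw [hf] at key
    simpa using! key.norm
  · obtain ⟨δ, hδ, hle⟩ := D.exists_pos_le (isClosed_tsupport g).isCompact
      (isClosed_tsupport f) hfg.symm
    obtain ⟨t₀, ht₀⟩ := hT (δ / 2) (half_pos hδ)
    filter_upwards [eventually_ge_atTop t₀] with t ht
    refine hπ.onePointAct_mul_mul_eq_zero (Set.disjoint_left.2 fun p hp hp' => ?_)
    have h1 := hle p.1 hp.1 p.2 hp.2
    have h2 := ht₀ t ht p hp'
    linarith

end OnePoint

/-- a bounded, strong-*-continuous operator family `T` with
`lim_t ‖[T_t, φ]‖ = 0` for all `φ ∈ C₀(X)` multiplies the representable localization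
algebra; in particular this applies whenever `prop(T_t) → 0` with respect to some
compatible metric on `X⁺`. -/
theorem statement2
    {X : Type*} [TopologicalSpace X] [T2Space X] [LocallyCompactSpace X]
    [SecondCountableTopology X]
    {H : Type*} [NormedAddCommGroup H] [InnerProductSpace ℂ H] [CompleteSpace H]
    [SecondCountableTopology H]
    (π : C₀(X, ℂ) → H →L[ℂ] H) (hπ : IsStarRep π) :
    (∀ T : ℝ → H →L[ℂ] H, OpBdd T → StrongStarContOn T → CommDecay π T →
      ∀ S ∈ RLc π,
        (fun t => (T t).comp (S t)) ∈ RLc π ∧ (fun t => (S t).comp (T t)) ∈ RLc π) ∧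
    (∀ D : CompatMetric (OnePoint X), ∀ T : ℝ → H →L[ℂ] H,
      OpBdd T → StrongStarContOn T → PropDecayPlus π D T →
      ∀ S ∈ RLc π,
        (fun t => (T t).comp (S t)) ∈ RLc π ∧ (fun t => (S t).comp (T t)) ∈ RLc π) := by
  refine ⟨fun T hb hc hT S hS => multiplier_RLc hπ hb hc hT hS, fun D T hb hc hp S hS => ?_⟩
  exact multiplier_RLc hπ hb hc (commDecay_of_propDecayPlus hπ D hb hp) hS

end Stmt
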